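/- arXiv:2006.02885 — 6 statements merged into one kernel-verified Lean document; each statement's English description precedes it below -/
import Mathlib

section
/- Let n₁, n₂ be natural numbers, let M be a real SPD matrix indexed by Fin n₁ ⊕ Fin n₂ with blocks M₁₁, M₁₂, M₂₁, M₂₂, and let N be an arbitrary real n₂ × n₁ matrix. Then the block matrix P = fromBlocks (M₁₁ − Nᵀ * M₂₁) (M₁₂ − Nᵀ * M₂₂) N 1 (whose lower-right block is the n₂ × n₂ identity) is nonsingular, i.e. det P ≠ 0. -/
open Matrix

/-- A real square matrix is SPD: symmetric and `xᵀ M x > 0` for every nonzero `x`. -/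
def Matrix.IsSPD {n : Type*} [Fintype n] (M : Matrix n n ℝ) : Prop :=
  M.IsSymm ∧ ∀ x : n → ℝ, x ≠ 0 → 0 < x ⬝ᵥ M.mulVec x

theorem stmt0 (n₁ n₂ : ℕ)
    (M : Matrix (Fin n₁ ⊕ Fin n₂) (Fin n₁ ⊕ Fin n₂) ℝ) (hM : M.IsSPD)
    (N : Matrix (Fin n₂) (Fin n₁) ℝ) :
    (Matrix.fromBlocks
        (M.toBlocks₁₁ - Nᵀ * M.toBlocks₂₁) (M.toBlocks₁₂ - Nᵀ * M.toBlocks₂₂)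
        N (1 : Matrix (Fin n₂) (Fin n₂) ℝ)).det ≠ 0 := by
  intro hdet
  obtain ⟨x, hx, hPx⟩ := Matrix.exists_mulVec_eq_zero_iff.mpr hdet
  obtain ⟨u, v, rfl⟩ : ∃ u v, x = Sum.elim u v := ⟨_, _, (Sum.elim_comp_inl_inr x).symm⟩
  have hpos := hM.2 _ hx
  rw [← M.fromBlocks_toBlocks] at hpos
  generalize M.toBlocks₁₁ = A at *
  generalize M.toBlocks₁₂ = B at *
  generalize M.toBlocks₂₁ = C at *
  generalize M.toBlocks₂₂ = D at *
  simp only [fromBlocks_mulVec, Sum.elim_comp_inl, Sum.elim_comp_inr,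
    sumElim_dotProduct_sumElim] at hpos hPx
  have htop : A *ᵥ u + B *ᵥ v = Nᵀ *ᵥ (C *ᵥ u + D *ᵥ v) := by
    have h : (A - Nᵀ * C) *ᵥ u + (B - Nᵀ * D) *ᵥ v = 0 :=
      funext fun i => congrFun hPx (Sum.inl i)
    rw [sub_mulVec, sub_mulVec, ← mulVec_mulVec, ← mulVec_mulVec] at h
    rw [mulVec_add, ← sub_eq_zero, ← h]
    abel
  have hbot : N *ᵥ u + v = 0 := by
    have h : N *ᵥ u + (1 : Matrix (Fin n₂) (Fin n₂) ℝ) *ᵥ v = 0 :=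
      funext fun i => congrFun hPx (Sum.inr i)
    rwa [one_mulVec] at h
  rw [htop, dotProduct_mulVec, vecMul_transpose, ← add_dotProduct, hbot,
    zero_dotProduct] at hpos
  exact lt_irrefl _ hpos
end

section
/- Let n_C, n_c be natural numbers, let 𝒞 be a real SPD matrix indexed by Fin n_C ⊕ Fin n_c with blocks 𝒞_CC, 𝒞_Cc, 𝒞_cC, 𝒞_cc, and let K be an arbitrary real n_C × n_c matrix. Then the block matrix fromBlocks (𝒞_CC + K * 𝒞_cC) (𝒞_Cc + K * 𝒞_cc) (−Kᵀ) 1 (with lower-right block the n_c × n_c identity) has nonzero determinant. -/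
open Matrix

/-- The capacitor block `J_𝒞` of the system Jacobian of the CpH circuit DAE is
nonsingular. -/
theorem stmt2 (n_C n_c : ℕ)
    (𝒞 : Matrix (Fin n_C ⊕ Fin n_c) (Fin n_C ⊕ Fin n_c) ℝ) (h𝒞 : 𝒞.IsSPD)
    (K : Matrix (Fin n_C) (Fin n_c) ℝ) :
    (Matrix.fromBlocks
        (𝒞.toBlocks₁₁ + K * 𝒞.toBlocks₂₁) (𝒞.toBlocks₁₂ + K * 𝒞.toBlocks₂₂)
        (-Kᵀ) (1 : Matrix (Fin n_c) (Fin n_c) ℝ)).det ≠ 0 := by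
  intro hdet
  obtain ⟨v, hv, hJ⟩ := Matrix.exists_mulVec_eq_zero_iff.mpr hdet
  obtain ⟨x, y, rfl⟩ : ∃ x y, v = Sum.elim x y :=
    ⟨v ∘ Sum.inl, v ∘ Sum.inr, (Sum.elim_comp_inl_inr v).symm⟩
  rw [fromBlocks_mulVec, Sum.elim_comp_inl, Sum.elim_comp_inr, ← Sum.elim_zero_zero,
    Sum.elim_eq_iff] at hJ
  obtain ⟨htop, hbot⟩ := hJ
  have hy : y = Kᵀ *ᵥ x := by
    rw [neg_mulVec, one_mulVec, neg_add_eq_zero] at hbot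
    exact hbot.symm
  have hK : (𝒞.toBlocks₁₁ *ᵥ x + 𝒞.toBlocks₁₂ *ᵥ y) +
      K *ᵥ (𝒞.toBlocks₂₁ *ᵥ x + 𝒞.toBlocks₂₂ *ᵥ y) = 0 := by
    rw [← htop]
    simp only [add_mulVec, mulVec_add, mulVec_mulVec]
    abel
  have hzero : Sum.elim x y ⬝ᵥ 𝒞 *ᵥ Sum.elim x y = 0 := by
    rw [← fromBlocks_toBlocks 𝒞, fromBlocks_mulVec, Sum.elim_comp_inl, Sum.elim_comp_inr,
      sumElim_dotProduct_sumElim]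
    nth_rewrite 2 [hy]
    rw [mulVec_transpose, ← dotProduct_mulVec, ← dotProduct_add, hK, dotProduct_zero]
  exact (h𝒞.2 _ hv).ne' hzero
end

section
/- Let n_l, n_L be natural numbers, let ℒ be a real SPD matrix indexed by Fin n_l ⊕ Fin n_L with blocks ℒ_ll, ℒ_lL, ℒ_Ll, ℒ_LL, and let K be an arbitrary real n_L × n_l matrix. Then the block matrix fromBlocks (ℒ_ll − Kᵀ * ℒ_Ll) (ℒ_lL − Kᵀ * ℒ_LL) K 1 (with lower-right block the n_L × n_L identity) has nonzero determinant. -/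
open Matrix

/-- The inductor block `J_ℒ` of the system Jacobian of the CpH circuit DAE is
nonsingular. -/
theorem stmt3 (n_l n_L : ℕ)
    (ℒ : Matrix (Fin n_l ⊕ Fin n_L) (Fin n_l ⊕ Fin n_L) ℝ) (hℒ : ℒ.IsSPD)
    (K : Matrix (Fin n_L) (Fin n_l) ℝ) :
    (Matrix.fromBlocks
        (ℒ.toBlocks₁₁ - Kᵀ * ℒ.toBlocks₂₁) (ℒ.toBlocks₁₂ - Kᵀ * ℒ.toBlocks₂₂)
        K (1 : Matrix (Fin n_L) (Fin n_L) ℝ)).det ≠ 0 := by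
  intro hdet
  obtain ⟨v, hv, hker⟩ := Matrix.exists_mulVec_eq_zero_iff.mpr hdet
  have hpos := hℒ.2 v hv
  rw [fromBlocks_mulVec] at hker
  set u := v ∘ Sum.inl with hu
  set w := v ∘ Sum.inr with hw
  have htop : (ℒ.toBlocks₁₁ - Kᵀ * ℒ.toBlocks₂₁) *ᵥ u
      + (ℒ.toBlocks₁₂ - Kᵀ * ℒ.toBlocks₂₂) *ᵥ w = 0 :=
    funext fun i => congrFun hker (Sum.inl i)
  have hbot : K *ᵥ u + (1 : Matrix (Fin n_L) (Fin n_L) ℝ) *ᵥ w = 0 :=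
    funext fun i => congrFun hker (Sum.inr i)
  rw [one_mulVec] at hbot
  have hflux : ℒ.toBlocks₁₁ *ᵥ u + ℒ.toBlocks₁₂ *ᵥ w
      = Kᵀ *ᵥ (ℒ.toBlocks₂₁ *ᵥ u + ℒ.toBlocks₂₂ *ᵥ w) := by
    rw [← sub_eq_zero, ← htop]
    simp only [sub_mulVec, mulVec_add, mulVec_mulVec]
    abel
  have hvuw : v = Sum.elim u w := (Sum.elim_comp_inl_inr v).symm
  have hzero : v ⬝ᵥ ℒ *ᵥ v = 0 := by
    conv_lhs => rw [← fromBlocks_toBlocks ℒ, fromBlocks_mulVec, ← hu, ← hw, hvuw]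
    rw [sumElim_dotProduct_sumElim, hflux, dotProduct_mulVec, vecMul_transpose,
      ← add_dotProduct, hbot, zero_dotProduct]
  exact hpos.ne' hzero
end

section
/- Let α and β be finite types with decidable equality and let M be a real square matrix indexed by α ⊕ β. Suppose that every permutation σ of α ⊕ β satisfying M i (σ i) ≠ 0 for all i maps every element of the form Sum.inl a to an element of the form Sum.inl a'. Then det M = det (M.toBlocks₁₁) * det (M.toBlocks₂₂), where M.toBlocks₁₁ and M.toBlocks₂₂ are the diagonal blocks of M on α and on β respectively. -/
open Matrix

/-- If every transversal of a square matrix indexed by `α ⊕ β` is confined to the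
diagonal blocks, then the determinant factors as the product of the determinants
of the two diagonal blocks. -/
theorem stmt4 (α β : Type*) [Fintype α] [Fintype β] [DecidableEq α] [DecidableEq β]
    (M : Matrix (α ⊕ β) (α ⊕ β) ℝ)
    (h : ∀ σ : Equiv.Perm (α ⊕ β), (∀ i, M i (σ i) ≠ 0) →
      ∀ a : α, ∃ a' : α, σ (Sum.inl a) = Sum.inl a') :
    M.det = M.toBlocks₁₁.det * M.toBlocks₂₂.det := by
  have key : M.det = (fromBlocks M.toBlocks₁₁ 0 M.toBlocks₂₁ M.toBlocks₂₂).det := by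
    rw [det_apply', det_apply']
    refine Finset.sum_congr rfl fun σ _ => congrArg _ ?_
    by_cases hσ : ∀ i, M (σ i) i ≠ 0
    · have hinl := h σ⁻¹ fun i => by simpa using hσ (σ⁻¹ i)
      refine Finset.prod_congr rfl fun i _ => ?_
      rcases hi : σ i with a | b <;> rcases i with a' | b'
      · rfl
      · obtain ⟨c, hc⟩ := hinl a
        simp [← hi] at hc
      · rfl
      · rfl
    · push Not at hσ
      obtain ⟨i, hi⟩ := hσ
      refine (Finset.prod_eq_zero (f := fun j => M (σ j) j) (Finset.mem_univ i) hi).trans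
        (Finset.prod_eq_zero (Finset.mem_univ i) ?_).symm
      generalize σ i = j at hi
      rcases j with a | b <;> rcases i with a' | b'
      · exact hi
      · rfl
      · exact hi
      · exact hi
  rw [key, det_fromBlocks_zero₁₂]
end

section
/- Let C, c, l, L, r, R be finite types and let ι be their disjoint sum C ⊕ c ⊕ l ⊕ L ⊕ r ⊕ R. Let Σ be a matrix indexed by ι × ι with entries in WithBot ℤ satisfying: (i) every entry is ≤ 1; (ii) every entry in a row indexed by C, l, r or R is ≤ 0; (iii) every entry in a row indexed by c whose column lies outside C ⊕ c is ≤ 0; (iv) every entry in a row indexed by L whose column lies outside l ⊕ L is ≤ 0; (v) every entry in a row indexed by C whose column lies outside C ⊕ c equals ⊥; (vi) every entry in a row indexed by l whose column lies outside l ⊕ L equals ⊥. Then every permutation π of ι whose transversal value ∑ i, Σ i (π i) equals Fintype.card c + Fintype.card L maps every index in C ⊕ c to an index in C ⊕ c, every index in l ⊕ L to an index in l ⊕ L, and every index in r ⊕ R to an index in r ⊕ R. -/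
section

variable {C c l L r R : Type*}

/-- Membership in the capacitor group `C ⊕ c` of the index type. -/
def memCc : C ⊕ c ⊕ l ⊕ L ⊕ r ⊕ R → Prop
  | .inl _ => True
  | .inr (.inl _) => True
  | _ => False

/-- Membership in the inductor group `l ⊕ L` of the index type. -/
def memlL : C ⊕ c ⊕ l ⊕ L ⊕ r ⊕ R → Prop
  | .inr (.inr (.inl _)) => True
  | .inr (.inr (.inr (.inl _))) => True
  | _ => False

/-- Membership in the resistor group `r ⊕ R` of the index type. -/
def memrR : C ⊕ c ⊕ l ⊕ L ⊕ r ⊕ R → Prop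
  | .inr (.inr (.inr (.inr _))) => True
  | _ => False

end

/-- In `WithBot ℤ`, a finite sum attaining a finite termwise upper bound attains it in each term. -/
theorem WithBot.eq_coe_of_sum_eq_coe_sum {ι : Type*} [Fintype ι] {f : ι → WithBot ℤ} {b : ι → ℤ}
    (hle : ∀ i, f i ≤ b i) (hsum : ∑ i, f i = ((∑ i, b i : ℤ) : WithBot ℤ)) (i : ι) :
    f i = b i := by
  have hbot : ∀ j, f j ≠ ⊥ := fun j hj =>
    WithBot.coe_ne_bot (hsum.symm.trans (WithBot.sum_eq_bot_iff.2 ⟨j, Finset.mem_univ j, hj⟩))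
  choose g hg using fun j => WithBot.ne_bot_iff_exists.1 (hbot j)
  obtain rfl : f = fun j => (g j : WithBot ℤ) := funext fun j => (hg j).symm
  have hsum' : ∑ j, g j = ∑ j, b j := by
    rw [← WithBot.coe_sum] at hsum
    exact WithBot.coe_injective hsum
  exact congrArg _ ((Finset.sum_eq_sum_iff_of_le fun j _ => WithBot.coe_le_coe.1 (hle j)).1
    hsum' i (Finset.mem_univ i))

/-- The row-wise upper bound on the entries: `1` in rows of `c` and `L`, and `0` elsewhere. -/
def rowBound {C c l L r R : Type*} : C ⊕ c ⊕ l ⊕ L ⊕ r ⊕ R → ℤ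
  | .inr (.inl _) => 1
  | .inr (.inr (.inr (.inl _))) => 1
  | _ => 0

theorem sum_rowBound {C c l L r R : Type*}
    [Fintype C] [Fintype c] [Fintype l] [Fintype L] [Fintype r] [Fintype R] :
    ∑ i : C ⊕ c ⊕ l ⊕ L ⊕ r ⊕ R, rowBound i = (Fintype.card c + Fintype.card L : ℕ) := by
  simp [Fintype.sum_sum_type, rowBound]

theorem memrR_iff {C c l L r R : Type*} (i : C ⊕ c ⊕ l ⊕ L ⊕ r ⊕ R) :
    memrR i ↔ ¬ memCc i ∧ ¬ memlL i := by
  rcases i with _ | _ | _ | _ | _ <;> simp [memCc, memlL, memrR]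

/-- Any transversal of the CpH signature matrix achieving the maximal value
`card c + card L` is confined to the three diagonal blocks. -/
theorem stmt6 (C c l L r R : Type*)
    [Fintype C] [Fintype c] [Fintype l] [Fintype L] [Fintype r] [Fintype R]
    (Sig : Matrix (C ⊕ c ⊕ l ⊕ L ⊕ r ⊕ R) (C ⊕ c ⊕ l ⊕ L ⊕ r ⊕ R) (WithBot ℤ))
    (h1 : ∀ i j, Sig i j ≤ 1)
    (hC : ∀ (a : C) j, Sig (.inl a) j ≤ 0)
    (hl : ∀ (a : l) j, Sig (.inr (.inr (.inl a))) j ≤ 0)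
    (hr : ∀ (a : r) j, Sig (.inr (.inr (.inr (.inr (.inl a))))) j ≤ 0)
    (hR : ∀ (a : R) j, Sig (.inr (.inr (.inr (.inr (.inr a))))) j ≤ 0)
    (hc : ∀ (a : c) j, ¬ memCc j → Sig (.inr (.inl a)) j ≤ 0)
    (hL : ∀ (a : L) j, ¬ memlL j → Sig (.inr (.inr (.inr (.inl a)))) j ≤ 0)
    (hCbot : ∀ (a : C) j, ¬ memCc j → Sig (.inl a) j = ⊥)
    (hlbot : ∀ (a : l) j, ¬ memlL j → Sig (.inr (.inr (.inl a))) j = ⊥) :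
    ∀ π : Equiv.Perm (C ⊕ c ⊕ l ⊕ L ⊕ r ⊕ R),
      (∑ i, Sig i (π i)) = ((Fintype.card c + Fintype.card L : ℕ) : WithBot ℤ) →
      (∀ i, memCc i → memCc (π i)) ∧ (∀ i, memlL i → memlL (π i)) ∧
        (∀ i, memrR i → memrR (π i)) := by
  intro π hπ
  have hle : ∀ i, Sig i (π i) ≤ (rowBound i : WithBot ℤ) := by
    rintro (a | a | a | a | a | a)
    · exact hC a _
    · exact h1 _ _
    · exact hl a _
    · exact h1 _ _
    · exact hr a _
    · exact hR a _
  have heq := WithBot.eq_coe_of_sum_eq_coe_sum hle (by rw [hπ, sum_rowBound, WithBot.coe_natCast])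
  have not_le : ¬ ((1 : ℤ) : WithBot ℤ) ≤ 0 := by
    exact_mod_cast (by norm_num : ¬ (1 : ℤ) ≤ 0)
  have hCc : ∀ i, memCc i → memCc (π i) := by
    rintro (a | a | i) hi
    · by_contra h
      exact WithBot.coe_ne_bot ((heq (.inl a)).symm.trans (hCbot a _ h))
    · by_contra h
      exact not_le ((heq (.inr (.inl a))).symm.trans_le (hc a _ h))
    · exact hi.elim
  have hlL : ∀ i, memlL i → memlL (π i) := by
    rintro (a | a | a | a | i) hi
    · exact hi.elim
    · exact hi.elim
    · by_contra h
      exact WithBot.coe_ne_bot ((heq (.inr (.inr (.inl a)))).symm.trans (hlbot a _ h))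
    · by_contra h
      exact not_le ((heq (.inr (.inr (.inr (.inl a))))).symm.trans_le (hL a _ h))
    · exact hi.elim
  refine ⟨hCc, hlL, fun i hi => ?_⟩
  have hCc' : memCc (π i) → memCc i := fun h => by
    simpa using Equiv.Perm.perm_symm_on_of_perm_on_finite (p := memCc) hCc h
  have hlL' : memlL (π i) → memlL i := fun h => by
    simpa using Equiv.Perm.perm_symm_on_of_perm_on_finite (p := memlL) hlL h
  rw [memrR_iff] at hi ⊢
  exact ⟨mt hCc' hi.1, mt hlL' hi.2⟩
end

section
/- Let n_C, n_c, n_l, n_L, n_r, n_R be natural numbers and let ι be the index type ((Fin n_C ⊕ Fin n_c) ⊕ (Fin n_l ⊕ Fin n_L)) ⊕ (Fin n_r ⊕ Fin n_R). Let J be a real square matrix indexed by ι such that: (a) every permutation σ of ι with J i (σ i) ≠ 0 for all i maps each of the three groups Fin n_C ⊕ Fin n_c, Fin n_l ⊕ Fin n_L and Fin n_r ⊕ Fin n_R into itself; (b) the diagonal block of J on Fin n_C ⊕ Fin n_c equals fromBlocks (𝒞_CC + K_C * 𝒞_cC) (𝒞_Cc + K_C * 𝒞_cc) (−K_Cᵀ)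 1 for some real SPD matrix 𝒞 indexed by Fin n_C ⊕ Fin n_c with blocks 𝒞_CC, 𝒞_Cc, 𝒞_cC, 𝒞_cc and some real n_C × n_c matrix K_C; (c) the diagonal block of J on Fin n_l ⊕ Fin n_L equals fromBlocks (ℒ_ll − K_Lᵀ * ℒ_Ll) (ℒ_lL − K_Lᵀ * ℒ_LL) K_L 1 for some real SPD matrix ℒ indexed by Fin n_l ⊕ Fin n_L with blocks ℒ_ll, ℒ_lL, ℒ_Ll, ℒ_LL and some real n_L × n_l matrix K_L; (d) the diagonal block of J on Fin n_r ⊕ Fin n_R equals fromBlocks (𝒢_rr − K_Rᵀ * 𝒢_Rr) (𝒢_rR − K_Rᵀ * 𝒢_RR) K_R 1 for some real SPD matrix 𝒢 indexed by Fin n_r ⊕ Fin n_R with blocks 𝒢_rr, 𝒢_rR, 𝒢_Rr, 𝒢_RR and some real n_R × n_r matrix K_R. Then det J ≠ 0. -/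
open Matrix

/-- If the entries of `N` vanish wherever those of `M` do, and agree with those of `M` along every
transversal of `M`, then `N` and `M` have the same determinant. -/
theorem Matrix.det_eq_of_forall_transversal {n R : Type*} [Fintype n] [DecidableEq n] [CommRing R]
    {M N : Matrix n n R} (h0 : ∀ i j, M i j = 0 → N i j = 0)
    (h : ∀ σ : Equiv.Perm n, (∀ i, M i (σ i) ≠ 0) → ∀ i, N i (σ i) = M i (σ i)) :
    M.det = N.det := by
  rw [← det_transpose M, ← det_transpose N, det_apply, det_apply]
  refine Finset.sum_congr rfl fun σ _ => ?_
  congr 1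
  simp only [transpose_apply]
  by_cases hσ : ∀ i, M i (σ i) ≠ 0
  · exact Finset.prod_congr rfl fun i _ => (h σ hσ i).symm
  · push Not at hσ
    obtain ⟨i, hi⟩ := hσ
    exact (Finset.prod_eq_zero (Finset.mem_univ i) hi).trans
      (Finset.prod_eq_zero (Finset.mem_univ i) (h0 i (σ i) hi)).symm

theorem Matrix.IsSPD.posDef {n : Type*} [Fintype n] {M : Matrix n n ℝ} (hM : M.IsSPD) :
    M.PosDef :=
  posDef_iff_dotProduct_mulVec.2
    ⟨by simpa [IsHermitian] using hM.1.eq, fun x hx => by simpa using hM.2 x hx⟩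

/-- The Schur complement of the identity block is the congruence of `S` by `[1 L]`, hence positive
definite. -/
theorem Matrix.IsSPD.det_fromBlocks_ne_zero {m n : Type*} [Fintype m] [Fintype n] [DecidableEq m]
    [DecidableEq n] {S : Matrix (m ⊕ n) (m ⊕ n) ℝ} (hS : S.IsSPD) (L : Matrix m n ℝ) :
    (fromBlocks (S.toBlocks₁₁ + L * S.toBlocks₂₁) (S.toBlocks₁₂ + L * S.toBlocks₂₂)
      (-Lᵀ) 1).det ≠ 0 := by
  have hinj : Function.Injective (fromCols (1 : Matrix m m ℝ) L).vecMul := fun x y hxy => by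
    simp only [vecMul_fromCols, vecMul_one] at hxy
    exact funext fun i => congrFun hxy (.inl i)
  have hpos := hS.posDef.mul_mul_conjTranspose_same hinj
  have hcongr : fromCols (1 : Matrix m m ℝ) L * S * (fromCols (1 : Matrix m m ℝ) L)ᴴ =
      S.toBlocks₁₁ + L * S.toBlocks₂₁ - (S.toBlocks₁₂ + L * S.toBlocks₂₂) * -Lᵀ := by
    conv_lhs => rw [← fromBlocks_toBlocks S]
    simp [fromCols_mul_fromBlocks, transpose_fromCols, fromCols_mul_fromRows]
  rw [det_fromBlocks_one₂₂, ← hcongr]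
  exact hpos.det_pos.ne'

/-- The system Jacobian of the CpH circuit DAE, defined by the provisional
offsets, is nonsingular: every transversal is confined to the three diagonal
blocks, and each diagonal block has the form shown to be nonsingular via an SPD
matrix, so `det J ≠ 0`. -/
theorem stmt8 (n_C n_c n_l n_L n_r n_R : ℕ)
    (J : Matrix (((Fin n_C ⊕ Fin n_c) ⊕ (Fin n_l ⊕ Fin n_L)) ⊕ (Fin n_r ⊕ Fin n_R))
                (((Fin n_C ⊕ Fin n_c) ⊕ (Fin n_l ⊕ Fin n_L)) ⊕ (Fin n_r ⊕ Fin n_R)) ℝ)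
    (ha : ∀ σ : Equiv.Perm (((Fin n_C ⊕ Fin n_c) ⊕ (Fin n_l ⊕ Fin n_L)) ⊕ (Fin n_r ⊕ Fin n_R)),
      (∀ i, J i (σ i) ≠ 0) →
      (∀ x : Fin n_C ⊕ Fin n_c, ∃ y : Fin n_C ⊕ Fin n_c, σ (.inl (.inl x)) = .inl (.inl y)) ∧
      (∀ x : Fin n_l ⊕ Fin n_L, ∃ y : Fin n_l ⊕ Fin n_L, σ (.inl (.inr x)) = .inl (.inr y)) ∧
      (∀ x : Fin n_r ⊕ Fin n_R, ∃ y : Fin n_r ⊕ Fin n_R, σ (.inr x) = .inr y))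
    (hb : ∃ (𝒞 : Matrix (Fin n_C ⊕ Fin n_c) (Fin n_C ⊕ Fin n_c) ℝ)
            (K_C : Matrix (Fin n_C) (Fin n_c) ℝ), 𝒞.IsSPD ∧
      (Matrix.of fun i j : Fin n_C ⊕ Fin n_c => J (.inl (.inl i)) (.inl (.inl j))) =
        Matrix.fromBlocks
          (𝒞.toBlocks₁₁ + K_C * 𝒞.toBlocks₂₁) (𝒞.toBlocks₁₂ + K_C * 𝒞.toBlocks₂₂)
          (-K_Cᵀ) (1 : Matrix (Fin n_c) (Fin n_c) ℝ))
    (hc : ∃ (ℒ : Matrix (Fin n_l ⊕ Fin n_L) (Fin n_l ⊕ Fin n_L) ℝ)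
            (K_L : Matrix (Fin n_L) (Fin n_l) ℝ), ℒ.IsSPD ∧
      (Matrix.of fun i j : Fin n_l ⊕ Fin n_L => J (.inl (.inr i)) (.inl (.inr j))) =
        Matrix.fromBlocks
          (ℒ.toBlocks₁₁ - K_Lᵀ * ℒ.toBlocks₂₁) (ℒ.toBlocks₁₂ - K_Lᵀ * ℒ.toBlocks₂₂)
          K_L (1 : Matrix (Fin n_L) (Fin n_L) ℝ))
    (hd : ∃ (𝒢 : Matrix (Fin n_r ⊕ Fin n_R) (Fin n_r ⊕ Fin n_R) ℝ)
            (K_R : Matrix (Fin n_R) (Fin n_r) ℝ), 𝒢.IsSPD ∧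
      (Matrix.of fun i j : Fin n_r ⊕ Fin n_R => J (.inr i) (.inr j)) =
        Matrix.fromBlocks
          (𝒢.toBlocks₁₁ - K_Rᵀ * 𝒢.toBlocks₂₁) (𝒢.toBlocks₁₂ - K_Rᵀ * 𝒢.toBlocks₂₂)
          K_R (1 : Matrix (Fin n_R) (Fin n_R) ℝ)) :
    J.det ≠ 0 := by
  obtain ⟨S, K, hS, hJ₁⟩ := hb
  obtain ⟨T, K', hT, hJ₂⟩ := hc
  obtain ⟨U, K'', hU, hJ₃⟩ := hd
  have h₁ := hS.det_fromBlocks_ne_zero K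
  have h₂ := hT.det_fromBlocks_ne_zero (-K'ᵀ)
  have h₃ := hU.det_fromBlocks_ne_zero (-K''ᵀ)
  simp only [Matrix.neg_mul, ← sub_eq_add_neg, transpose_neg, transpose_transpose, neg_neg]
    at h₂ h₃
  rw [← hJ₁] at h₁
  rw [← hJ₂] at h₂
  rw [← hJ₃] at h₃
  rw [det_eq_of_forall_transversal (M := J) (N := fromBlocks
    (fromBlocks (of fun i j => J (.inl (.inl i)) (.inl (.inl j))) 0 0
      (of fun i j => J (.inl (.inr i)) (.inl (.inr j)))) 0 0 (of fun i j => J (.inr i) (.inr j))),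
    det_fromBlocks_zero₂₁, det_fromBlocks_zero₂₁]
  · exact mul_ne_zero (mul_ne_zero h₁ h₂) h₃
  · rintro ((i | i) | i) ((j | j) | j) h <;> simp [h]
  · intro σ hσ
    obtain ⟨hσ₁, hσ₂, hσ₃⟩ := ha σ hσ
    rintro ((i | i) | i)
    · obtain ⟨j, hj⟩ := hσ₁ i
      simp [hj]
    · obtain ⟨j, hj⟩ := hσ₂ i
      simp [hj]
    · obtain ⟨j, hj⟩ := hσ₃ i
      simp [hj]
end
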